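/- Let A ≥ 1, n ≥ 1, and B be integers. Then: (a) there exist unique rationals c_0, …, c_n such that the polynomial p(X,Y) = Σ_{i=0}^{n} c_i·[X]_{n−i}·[Y]_i satisfies p(−A, Y) = [Y − B]_n as polynomials in ℚ[Y]; (b) every polynomial q of the form q(X,Y) = Σ_{i=0}^{n} c'_i·[X]_{n−i}·[Y]_i with q(−A, B+j) = 0 for j = 0, 1, …, n−1 is a scalar multiple of p; and (c) this p satisfies A·p(−A−1, Y) = [Y − B − 1]_{n−1}·(A·(Y − B) − n·B) as polynomials in ℚ[Y]. -/

import Mathlib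

/-- The basis polynomial `[X]_{n−i}·[Y]_i ∈ ℚ[X,Y]`. -/
noncomputable def basisPoly (n i : ℕ) : MvPolynomial (Fin 2) ℚ :=
  Polynomial.aeval (MvPolynomial.X 0) (descPochhammer ℚ (n - i)) *
    Polynomial.aeval (MvPolynomial.X 1) (descPochhammer ℚ i)

/-- Substitution `p(a, g)` of a rational `a` for `X` and a one-variable polynomial
`g` for `Y` in `p ∈ ℚ[X,Y]`, producing an element of `ℚ[Y]`. -/
noncomputable def substXY (a : ℚ) (g : Polynomial ℚ) (p : MvPolynomial (Fin 2) ℚ) :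
    Polynomial ℚ :=
  MvPolynomial.aeval ![Polynomial.C a, g] p

open Polynomial in
/-- Falling factorials as a sequence of polynomials with one of each degree. -/
noncomputable def descPochhammerSequence : Polynomial.Sequence ℚ where
  elems' := descPochhammer ℚ
  degree_eq' i := by
    rw [degree_eq_natDegree (monic_descPochhammer ℚ i).ne_zero, descPochhammer_natDegree]

lemma linearIndependent_descPochhammer (n : ℕ) :
    LinearIndependent ℚ (fun i : Fin n ↦ descPochhammer ℚ i) :=
  descPochhammerSequence.linearIndependent.comp _ Fin.val_injective

lemma exists_sum_smul_descPochhammer_eq {n : ℕ} {q : Polynomial ℚ} (hq : q.degree < n) :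
    ∃ b : Fin n → ℚ, ∑ i, b i • descPochhammer ℚ i = q := by
  rw [← Polynomial.mem_degreeLT, ← descPochhammerSequence.span_degreeLT
    (fun i _ ↦ (Polynomial.leadingCoeff_ne_zero.2 (descPochhammerSequence.ne_zero i)).isUnit)] at hq
  rw [← Submodule.mem_span_range_iff_exists_fun]
  have h_range : Set.range (fun i : Fin n ↦ descPochhammer ℚ i) =
      descPochhammerSequence '' Set.Iio n := by
    ext p
    simp only [Set.mem_range, Set.mem_image, Set.mem_Iio]
    exact ⟨fun ⟨i, hi⟩ ↦ ⟨i, i.2, hi⟩, fun ⟨i, hi, h⟩ ↦ ⟨⟨i, hi⟩, h⟩⟩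
  rwa [h_range]

lemma X_mul_descPochhammer_sub_comp_X_sub_one (i : ℕ) :
    Polynomial.X * (descPochhammer ℚ i - (descPochhammer ℚ i).comp (Polynomial.X - 1)) =
      (i : ℚ) • descPochhammer ℚ i := by
  cases i with
  | zero => simp
  | succ k =>
    rw [descPochhammer_succ_comp_X_sub_one, sub_sub_cancel, smul_eq_mul, mul_left_comm,
      ← descPochhammer_succ_left, Polynomial.smul_eq_C_mul]
    simp

lemma mul_eval_sub_one_descPochhammer (k : ℕ) (a : ℚ) :
    a * (descPochhammer ℚ k).eval (a - 1) = (a - k) * (descPochhammer ℚ k).eval a := by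
  have h := descPochhammer_succ_eval k a
  rw [descPochhammer_succ_left] at h
  simpa [mul_comm] using h

lemma descPochhammer_eval_ne_zero_of_neg {a : ℚ} (ha : a < 0) (k : ℕ) :
    (descPochhammer ℚ k).eval a ≠ 0 := by
  induction k with
  | zero => simp
  | succ k ih =>
    rw [descPochhammer_succ_eval]
    have : (0 : ℚ) ≤ k := k.cast_nonneg
    exact mul_ne_zero ih (by linarith)

lemma degree_sum_smul_descPochhammer_lt {n : ℕ} (b : Fin n → ℚ) :
    (∑ i, b i • descPochhammer ℚ i).degree < n := by
  rw [← Polynomial.mem_degreeLT]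
  refine Submodule.sum_mem _ fun i _ ↦ Submodule.smul_mem _ _ ?_
  rw [Polynomial.mem_degreeLT]
  exact (descPochhammerSequence.degree_eq i).trans_lt (by exact_mod_cast i.2)

lemma monic_descPochhammer_comp_X_sub_C (n : ℕ) (b : ℚ) :
    ((descPochhammer ℚ n).comp (Polynomial.X - Polynomial.C b)).Monic :=
  (monic_descPochhammer ℚ n).comp (Polynomial.monic_X_sub_C b) (by simp)

lemma degree_descPochhammer_comp_X_sub_C (n : ℕ) (b : ℚ) :
    ((descPochhammer ℚ n).comp (Polynomial.X - Polynomial.C b)).degree = n := by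
  rw [Polynomial.degree_eq_natDegree (monic_descPochhammer_comp_X_sub_C n b).ne_zero,
    Polynomial.natDegree_comp]
  simp

lemma eq_smul_descPochhammer_comp_of_eval_eq_zero {n : ℕ} {b : ℚ} {q : Polynomial ℚ}
    (hq : q.degree < (n + 1 : ℕ)) (h : ∀ j < n, q.eval (b + j) = 0) :
    q = q.coeff n • (descPochhammer ℚ n).comp (Polynomial.X - Polynomial.C b) := by
  rw [← sub_eq_zero]
  refine Polynomial.eq_zero_of_degree_lt_of_eval_index_eq_zero (s := Finset.range n)
    (v := fun j : ℕ ↦ b + (j : ℚ)) (fun i _ j _ hij ↦ by simpa using hij) ?_ fun j hj ↦ ?_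
  · rw [Finset.card_range, Polynomial.degree_lt_iff_coeff_zero]
    intro m hm
    rcases hm.eq_or_lt with rfl | hm
    · have hd : ((descPochhammer ℚ n).comp (Polynomial.X - Polynomial.C b)).natDegree = n :=
        Polynomial.natDegree_eq_of_degree_eq_some (degree_descPochhammer_comp_X_sub_C n b)
      have hc := (monic_descPochhammer_comp_X_sub_C n b).coeff_natDegree
      rw [hd] at hc
      simp [hc]
    · rw [Polynomial.coeff_sub, Polynomial.coeff_smul,
        (Polynomial.degree_lt_iff_coeff_zero _ _).1 hq m hm,
        Polynomial.coeff_eq_zero_of_degree_lt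
          ((degree_descPochhammer_comp_X_sub_C n b).trans_lt (by exact_mod_cast hm))]
      simp
  · have hj := Finset.mem_range.1 hj
    simp [h j hj, descPochhammer_eval_coe_nat_of_lt hj]

lemma substXY_sum_basisPoly (a : ℚ) (n : ℕ) (c : Fin (n + 1) → ℚ) :
    substXY a Polynomial.X (∑ i : Fin (n + 1), MvPolynomial.C (c i) * basisPoly n i) =
      ∑ i : Fin (n + 1), (c i * (descPochhammer ℚ (n - i)).eval a) • descPochhammer ℚ i := by
  simp only [substXY, basisPoly, map_sum, map_mul, ← Polynomial.aeval_algHom_apply,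
    MvPolynomial.aeval_X, MvPolynomial.algHom_C, Matrix.cons_val_zero, Matrix.cons_val_one,
    Polynomial.aeval_X_left_apply, Polynomial.algebraMap_eq]
  refine Finset.sum_congr rfl fun i _ ↦ ?_
  rw [← Polynomial.algebraMap_eq, Polynomial.aeval_algebraMap_apply, Polynomial.algebraMap_eq,
    Polynomial.smul_eq_C_mul, Polynomial.coe_aeval_eq_eval, map_mul, mul_assoc]

lemma eval_substXY_X (a y : ℚ) (p : MvPolynomial (Fin 2) ℚ) :
    (substXY a Polynomial.X p).eval y = MvPolynomial.eval ![a, y] p := by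
  rw [substXY, ← Polynomial.coe_aeval_eq_eval]
  refine (MvPolynomial.comp_aeval_apply _ ((Polynomial.aeval y).restrictScalars ℚ) p).trans ?_
  rw [← MvPolynomial.aeval_eq_eval]
  congr 2
  ext i
  fin_cases i <;> simp

lemma substXY_sum_basisPoly_injective {a : ℚ} (ha : a < 0) (n : ℕ) :
    Function.Injective fun c : Fin (n + 1) → ℚ ↦
      substXY a Polynomial.X (∑ i : Fin (n + 1), MvPolynomial.C (c i) * basisPoly n i) := by
  intro c c' h
  simp only [substXY_sum_basisPoly] at h
  ext i
  exact mul_right_cancel₀ (descPochhammer_eval_ne_zero_of_neg ha (n - i))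
    (Fintype.linearIndependent_iffₛ.1 (linearIndependent_descPochhammer (n + 1)) _ _ h i)

lemma exists_substXY_sum_basisPoly_eq {a : ℚ} (ha : a < 0) {n : ℕ} {q : Polynomial ℚ}
    (hq : q.degree < (n + 1 : ℕ)) : ∃ c : Fin (n + 1) → ℚ,
      substXY a Polynomial.X (∑ i : Fin (n + 1), MvPolynomial.C (c i) * basisPoly n i) = q := by
  obtain ⟨b, rfl⟩ := exists_sum_smul_descPochhammer_eq hq
  refine ⟨fun i ↦ b i / (descPochhammer ℚ (n - i)).eval a, ?_⟩
  simp only [substXY_sum_basisPoly, div_mul_cancel₀ _ (descPochhammer_eval_ne_zero_of_neg ha _)]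

/-- Shifting the first argument by one, in terms of the backward difference in the second. -/
lemma C_mul_substXY_sub_one (a : ℚ) (n : ℕ) (c : Fin (n + 1) → ℚ) (p : Polynomial ℚ)
    (hp : substXY a Polynomial.X
      (∑ i : Fin (n + 1), MvPolynomial.C (c i) * basisPoly n i) = p) :
    Polynomial.C a * substXY (a - 1) Polynomial.X
        (∑ i : Fin (n + 1), MvPolynomial.C (c i) * basisPoly n i) =
      Polynomial.C (a - n) * p + Polynomial.X * (p - p.comp (Polynomial.X - 1)) := by
  rw [substXY_sum_basisPoly] at hp ⊢
  subst hp
  rw [Polynomial.sum_comp, ← Finset.sum_sub_distrib, Finset.mul_sum, Finset.mul_sum,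
    Finset.mul_sum, ← Finset.sum_add_distrib]
  refine Finset.sum_congr rfl fun i _ ↦ ?_
  simp only [Polynomial.smul_comp, ← smul_sub, mul_smul_comm,
    X_mul_descPochhammer_sub_comp_X_sub_one, ← Polynomial.smul_eq_C_mul, smul_smul, ← add_smul]
  congr 1
  have h := mul_eval_sub_one_descPochhammer (n - i) a
  rw [Nat.cast_sub (Nat.lt_succ_iff.1 i.2)] at h
  linear_combination c i * h

/-- Let `A ≥ 1`, `n ≥ 1` and `B` be integers. Then:
(a) there exist unique rationals `c_0, …, c_n` such that
`p(X,Y) = Σ c_i·[X]_{n−i}·[Y]_i` satisfies `p(−A, Y) = [Y − B]_n`;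
(b) every `q(X,Y) = Σ c'_i·[X]_{n−i}·[Y]_i` with `q(−A, B+j) = 0` for
`j = 0, …, n−1` is a scalar multiple of `p`; and
(c) `A·p(−A−1, Y) = [Y − B − 1]_{n−1}·(A·(Y − B) − n·B)` in `ℚ[Y]`. -/
theorem stmt4 (A : ℤ) (hA : 1 ≤ A) (n : ℕ) (hn : 1 ≤ n) (B : ℤ) :
    (∃! c : Fin (n + 1) → ℚ,
      substXY (-(A : ℚ)) Polynomial.X
          (∑ i : Fin (n + 1), MvPolynomial.C (c i) * basisPoly n (i : ℕ)) =
        (descPochhammer ℚ n).comp (Polynomial.X - Polynomial.C (B : ℚ))) ∧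
    ∀ c : Fin (n + 1) → ℚ,
      substXY (-(A : ℚ)) Polynomial.X
          (∑ i : Fin (n + 1), MvPolynomial.C (c i) * basisPoly n (i : ℕ)) =
        (descPochhammer ℚ n).comp (Polynomial.X - Polynomial.C (B : ℚ)) →
      ((∀ c' : Fin (n + 1) → ℚ,
          (∀ j : ℕ, j < n →
            MvPolynomial.eval ![-(A : ℚ), (B : ℚ) + (j : ℚ)]
              (∑ i : Fin (n + 1), MvPolynomial.C (c' i) * basisPoly n (i : ℕ)) = 0) →
          ∃ s : ℚ,
            (∑ i : Fin (n + 1), MvPolynomial.C (c' i) * basisPoly n (i : ℕ)) =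
              s • ∑ i : Fin (n + 1), MvPolynomial.C (c i) * basisPoly n (i : ℕ)) ∧
        Polynomial.C (A : ℚ) * substXY (-(A : ℚ) - 1) Polynomial.X
            (∑ i : Fin (n + 1), MvPolynomial.C (c i) * basisPoly n (i : ℕ)) =
          (descPochhammer ℚ (n - 1)).comp (Polynomial.X - Polynomial.C ((B : ℚ) + 1)) *
            (Polynomial.C (A : ℚ) * (Polynomial.X - Polynomial.C (B : ℚ)) -
              Polynomial.C ((n : ℚ) * (B : ℚ)))) := by
  have ha : -(A : ℚ) < 0 := by
    have : (1 : ℚ) ≤ A := by exact_mod_cast hA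
    linarith
  have hdeg : ((descPochhammer ℚ n).comp (Polynomial.X - Polynomial.C (B : ℚ))).degree <
      (n + 1 : ℕ) := by
    rw [degree_descPochhammer_comp_X_sub_C]
    exact_mod_cast n.lt_succ_self
  refine ⟨?_, fun c hc ↦ ⟨fun c' hc' ↦ ?_, ?_⟩⟩
  · obtain ⟨c, hc⟩ := exists_substXY_sum_basisPoly_eq ha hdeg
    exact ⟨c, hc, fun c' hc' ↦ substXY_sum_basisPoly_injective ha n (hc'.trans hc.symm)⟩
  · set q := substXY (-(A : ℚ)) Polynomial.X
      (∑ i : Fin (n + 1), MvPolynomial.C (c' i) * basisPoly n i) with hq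
    have hq_deg : q.degree < (n + 1 : ℕ) := by
      rw [hq, substXY_sum_basisPoly]
      exact degree_sum_smul_descPochhammer_lt fun i : Fin (n + 1) ↦
        c' i * (descPochhammer ℚ (n - i)).eval (-(A : ℚ))
    have hq_eq := eq_smul_descPochhammer_comp_of_eval_eq_zero hq_deg
      fun j hj ↦ (eval_substXY_X _ _ _).trans (hc' j hj)
    have hsum : q.coeff n • ∑ i : Fin (n + 1), MvPolynomial.C (c i) * basisPoly n i =
        ∑ i : Fin (n + 1), MvPolynomial.C ((q.coeff n • c) i) * basisPoly n i := by
      simp [Finset.smul_sum, MvPolynomial.smul_eq_C_mul, mul_assoc]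
    have hc'_eq : c' = q.coeff n • c := by
      refine substXY_sum_basisPoly_injective ha n ?_
      simp only [← hsum]
      refine hq_eq.trans ?_
      rw [← hc]
      simp only [substXY, map_smul]
    exact ⟨q.coeff n, by rw [hsum, ← hc'_eq]⟩
  · have h := C_mul_substXY_sub_one _ n c _ hc
    obtain ⟨m, rfl⟩ := Nat.exists_eq_add_of_le' hn
    have hcomp : ((descPochhammer ℚ (m + 1)).comp (Polynomial.X - Polynomial.C (B : ℚ))).comp
        (Polynomial.X - 1) = ((descPochhammer ℚ (m + 1)).comp (Polynomial.X - 1)).comp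
          (Polynomial.X - Polynomial.C (B : ℚ)) := by
      simp only [Polynomial.comp_assoc]
      congr 1
      simp
      ring
    have hshift : (descPochhammer ℚ m).comp (Polynomial.X - Polynomial.C ((B : ℚ) + 1)) =
        ((descPochhammer ℚ m).comp (Polynomial.X - 1)).comp
          (Polynomial.X - Polynomial.C (B : ℚ)) := by
      rw [Polynomial.comp_assoc]
      congr 1
      simp
      ring
    rw [hcomp, descPochhammer_succ_comp_X_sub_one, descPochhammer_succ_left] at h
    rw [Nat.add_sub_cancel, hshift]
    simp only [Polynomial.sub_comp, Polynomial.mul_comp, Polynomial.X_comp, smul_eq_mul,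
      Polynomial.add_comp, Polynomial.natCast_comp, Polynomial.one_comp, map_neg, map_sub, map_mul,
      map_add, map_one, map_natCast, Nat.cast_add, Nat.cast_one] at h ⊢
    linear_combination -h
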